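/- Let X be a real-valued random variable whose characteristic function φ(θ) = E[exp(iθX)] satisfies |φ(θ)| ≤ min(1, C|θ|^{-(1+γ)}) for all θ ∈ ℝ, for some constant C > 0 and some γ ∈ (0,1). Then the law of X has a density function f_X with respect to Lebesgue measure, and f_X is α-Hölder continuous for every α ∈ (0, γ). -/

import Mathlib

open MeasureTheory

open ProbabilityTheory Filter Topology FourierTransform
open scoped NNReal ENNReal

/-- The value at `x` of the density of the convolution of `μ` with a centered Gaussian of
variance `v`, written as a Fourier integral. -/
lemma integral_gaussian_mul_charFun (μ : Measure ℝ) [IsProbabilityMeasure μ] {v : ℝ≥0}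
    (hv : v ≠ 0) (x : ℝ) :
    ∫ ξ : ℝ, Complex.exp (-(2 * Real.pi ^ 2 * v : ℝ) * (ξ : ℂ) ^ 2) *
        (Complex.exp (↑(-2 * Real.pi * ξ * x) * Complex.I) * charFun μ (2 * Real.pi * ξ)) =
      ((∫ y, gaussianPDFReal y v x ∂μ : ℝ) : ℂ) := by
  have hb : 0 < 2 * Real.pi ^ 2 * (v : ℝ) := by positivity
  set b : ℝ := 2 * Real.pi ^ 2 * v with hb_def
  have inner_eq (y : ℝ) : ∫ ξ : ℝ, Complex.exp (-(b : ℂ) * (ξ : ℂ) ^ 2) *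
      (Complex.exp (↑(-2 * Real.pi * ξ * x) * Complex.I) *
        Complex.exp (↑(2 * Real.pi * ξ) * y * Complex.I)) = (gaussianPDFReal y v x : ℂ) := by
    have h := fourierIntegral_gaussian (b := (b : ℂ)) (by simpa using hb)
      ((2 * Real.pi * (y - x) : ℝ) : ℂ)
    trans ∫ ξ : ℝ, Complex.exp (Complex.I * ((2 * Real.pi * (y - x) : ℝ) : ℂ) * ξ) *
      Complex.exp (-(b : ℂ) * (ξ : ℂ) ^ 2)
    · congr with ξ
      rw [← Complex.exp_add, ← Complex.exp_add, ← Complex.exp_add]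
      congr 1
      push_cast
      ring
    · rw [h, gaussianPDFReal, Real.sqrt_eq_rpow, ← Real.inv_rpow (by positivity)]
      push_cast [Complex.ofReal_cpow (show (0 : ℝ) ≤ (2 * Real.pi * v)⁻¹ by positivity)]
      congr 2
      · rw [hb_def]
        push_cast
        field_simp
      · rw [hb_def]
        push_cast
        field_simp
        ring
  have hint : Integrable (Function.uncurry fun (ξ y : ℝ) ↦
      Complex.exp (-(b : ℂ) * (ξ : ℂ) ^ 2) *
      (Complex.exp (↑(-2 * Real.pi * ξ * x) * Complex.I) *
        Complex.exp (↑(2 * Real.pi * ξ) * y * Complex.I))) (volume.prod μ) := by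
    have h := (integrable_exp_neg_mul_sq hb).mul_prod (integrable_const (1 : ℝ) (μ := μ))
    refine h.mono' (Continuous.aestronglyMeasurable (by unfold Function.uncurry; fun_prop)) ?_
    refine .of_forall fun p ↦ le_of_eq ?_
    simp only [Function.uncurry, norm_mul, Complex.norm_exp, ← Real.exp_add, mul_one]
    norm_cast
    simp
  simp_rw [charFun_apply_real, ← integral_const_mul]
  rw [integral_integral_swap hint, ← integral_complex_ofReal]
  exact integral_congr_ae (.of_forall inner_eq)

lemma measurable_gaussianPDFReal_uncurry (v : ℝ≥0) :
    Measurable fun p : ℝ × ℝ ↦ gaussianPDFReal p.2 v p.1 := by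
  unfold gaussianPDFReal
  fun_prop

lemma tendsto_integral_gaussianPDFReal (μ : Measure ℝ) [IsProbabilityMeasure μ]
    (h : Integrable fun ξ ↦ charFun μ (2 * Real.pi * ξ)) (x : ℝ) :
    Tendsto (fun n : ℕ ↦ ((∫ y, gaussianPDFReal y ((n : ℝ≥0) + 1)⁻¹ x ∂μ : ℝ) : ℂ)) atTop
      (𝓝 (𝓕 (fun ξ ↦ charFun μ (2 * Real.pi * ξ)) x)) := by
  have hint : Integrable fun ξ : ℝ ↦
      Complex.exp (↑(-2 * Real.pi * ξ * x) * Complex.I) * charFun μ (2 * Real.pi * ξ) := by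
    refine h.mono (AEStronglyMeasurable.mul (Continuous.aestronglyMeasurable (by fun_prop)) h.1)
      (.of_forall fun ξ ↦ ?_)
    rw [norm_mul, Complex.norm_exp_ofReal_mul_I, one_mul]
  have hc : Tendsto (fun n : ℕ ↦ (2 * Real.pi ^ 2)⁻¹ * ((n : ℝ) + 1)) atTop atTop :=
    (tendsto_atTop_add_const_right _ _ tendsto_natCast_atTop_atTop).const_mul_atTop
      (by positivity)
  have key := (Real.tendsto_integral_cexp_sq_smul hint).comp hc
  rw [Real.fourier_real_eq_integral_exp_smul]
  refine key.congr fun n ↦ ?_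
  rw [← integral_gaussian_mul_charFun μ (by positivity) x, Function.comp_apply]
  congr with ξ
  rw [smul_eq_mul]
  congr 2
  rw [Real.norm_eq_abs, ← Complex.ofReal_pow, ← Complex.ofReal_pow, sq_abs]
  push_cast
  field_simp

lemma lintegral_integral_gaussianPDFReal (μ : Measure ℝ) [IsProbabilityMeasure μ] {v : ℝ≥0}
    (hv : v ≠ 0) :
    ∫⁻ x, ENNReal.ofReal (∫ y, gaussianPDFReal y v x ∂μ) = 1 := by
  have hint (x : ℝ) : Integrable (fun y ↦ gaussianPDFReal y v x) μ := by
    refine (integrable_const (√(2 * Real.pi * v))⁻¹).mono'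
      ((measurable_gaussianPDFReal_uncurry v).comp (by fun_prop : Measurable fun y ↦ (x, y))
        ).aestronglyMeasurable (.of_forall fun y ↦ ?_)
    rw [Real.norm_of_nonneg (gaussianPDFReal_nonneg _ _ _), gaussianPDFReal]
    refine mul_le_of_le_one_right (by positivity) (Real.exp_le_one_iff.2 ?_)
    exact div_nonpos_of_nonpos_of_nonneg (neg_nonpos.2 (sq_nonneg _)) (by positivity)
  simp_rw [fun x ↦ ofReal_integral_eq_lintegral_ofReal (hint x)
    (.of_forall fun y ↦ gaussianPDFReal_nonneg y v x)]
  rw [lintegral_lintegral_swap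
    (measurable_gaussianPDFReal_uncurry v).ennreal_ofReal.aemeasurable]
  simp [lintegral_gaussianPDFReal_eq_one _ hv]

/-- A probability measure on `ℝ` with integrable characteristic function has a nonnegative
density, given by the Fourier transform of `ξ ↦ charFun μ (2 * π * ξ)`. -/
theorem exists_density_of_integrable_charFun (μ : Measure ℝ) [IsProbabilityMeasure μ]
    (h : Integrable (charFun μ)) :
    ∃ f : ℝ → ℝ, (∀ x, 0 ≤ f x) ∧
      (∀ x, 𝓕 (fun ξ ↦ charFun μ (2 * Real.pi * ξ)) x = f x) ∧
      μ = volume.withDensity (fun x ↦ ENNReal.ofReal (f x)) := by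
  have h' : Integrable fun ξ ↦ charFun μ (2 * Real.pi * ξ) := h.comp_mul_left' (by positivity)
  set g : ℝ → ℂ := fun ξ ↦ charFun μ (2 * Real.pi * ξ) with hg
  have hg_cont : Continuous g := continuous_charFun.comp (by fun_prop)
  have hlim (x : ℝ) := tendsto_integral_gaussianPDFReal μ h' x
  have hlim_re (x : ℝ) : Tendsto (fun n : ℕ ↦ ∫ y, gaussianPDFReal y ((n : ℝ≥0) + 1)⁻¹ x ∂μ) atTop
      (𝓝 (𝓕 g x).re) := (Complex.continuous_re.tendsto _).comp (hlim x)
  have him (x : ℝ) : (𝓕 g x).im = 0 :=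
    tendsto_nhds_unique ((Complex.continuous_im.tendsto _).comp (hlim x))
      (by simp [Function.comp_def])
  have heq (x : ℝ) : 𝓕 g x = ((𝓕 g x).re : ℂ) := Complex.ext (by simp) (by simp [him x])
  have hnonneg (x : ℝ) : 0 ≤ (𝓕 g x).re := ge_of_tendsto' (hlim_re x) fun n ↦
    integral_nonneg fun y ↦ gaussianPDFReal_nonneg _ _ _
  have hcont : Continuous (𝓕 g) :=
    VectorFourier.fourierIntegral_continuous Real.continuous_fourierChar
      (L := innerₗ ℝ) continuous_inner h'
  have hcont_re : Continuous fun x ↦ (𝓕 g x).re := Complex.continuous_re.comp hcont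
  have hle : ∫⁻ x, ENNReal.ofReal (𝓕 g x).re ≤ 1 := by
    have hmeas (n : ℕ) : Measurable fun x ↦
        ENNReal.ofReal (∫ y, gaussianPDFReal y ((n : ℝ≥0) + 1)⁻¹ x ∂μ) :=
      ((measurable_gaussianPDFReal_uncurry _).stronglyMeasurable.integral_prod_right
        ).measurable.ennreal_ofReal
    calc ∫⁻ x, ENNReal.ofReal (𝓕 g x).re
      _ = ∫⁻ x, liminf (fun n : ℕ ↦
          ENNReal.ofReal (∫ y, gaussianPDFReal y ((n : ℝ≥0) + 1)⁻¹ x ∂μ)) atTop :=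
        lintegral_congr fun x ↦ (ENNReal.tendsto_ofReal (hlim_re x)).liminf_eq.symm
      _ ≤ _ := lintegral_liminf_le hmeas
      _ = 1 := by
        simp_rw [fun n : ℕ ↦ lintegral_integral_gaussianPDFReal μ
          (v := ((n : ℝ≥0) + 1)⁻¹) (by positivity)]
        simp
  have hint_re : Integrable fun x ↦ (𝓕 g x).re :=
    ⟨hcont_re.aestronglyMeasurable, by
      rw [hasFiniteIntegral_iff_ofReal (.of_forall hnonneg)]
      exact hle.trans_lt ENNReal.one_lt_top⟩
  have hint : Integrable (𝓕 g) := by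
    rw [show 𝓕 g = fun x ↦ ((𝓕 g x).re : ℂ) from funext heq]
    exact hint_re.ofReal
  refine ⟨fun x ↦ (𝓕 g x).re, hnonneg, heq, ?_⟩
  have : IsFiniteMeasure (volume.withDensity fun x ↦ ENNReal.ofReal (𝓕 g x).re) :=
    isFiniteMeasure_withDensity (hle.trans_lt ENNReal.one_lt_top).ne
  refine Measure.ext_of_charFun (funext fun t ↦ ?_)
  have hinv := congrFun (hg_cont.fourierInv_fourier_eq h' hint) (t / (2 * Real.pi))
  have ht : 2 * Real.pi * (t / (2 * Real.pi)) = t := by field_simp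
  rw [hg] at hinv
  simp only [ht] at hinv
  rw [← hinv, Real.fourierInv_eq', charFun_apply_real, integral_withDensity_eq_integral_toReal_smul
    hcont_re.measurable.ennreal_ofReal (.of_forall fun _ ↦ ENNReal.ofReal_lt_top)]
  refine integral_congr_ae (.of_forall fun x ↦ ?_)
  simp only [ENNReal.toReal_ofReal (hnonneg x)]
  rw [← hg, heq x, smul_eq_mul, Complex.real_smul, Complex.ofReal_re, mul_comm]
  congr 3
  rw [← Complex.ofReal_mul]
  congr 1
  simp
  field_simp

lemma norm_charFun_le_japaneseBracket {φ : ℝ → ℂ} {C s : ℝ} (hC : 0 ≤ C) (hs : 0 ≤ s)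
    (h1 : ∀ θ, ‖φ θ‖ ≤ 1) (h2 : ∀ θ, θ ≠ 0 → ‖φ θ‖ ≤ C * |θ| ^ (-s)) (θ : ℝ) :
    ‖φ θ‖ ≤ (1 + C) * 2 ^ s * (1 + ‖θ‖) ^ (-s) := by
  have hn : 0 ≤ |θ| := abs_nonneg θ
  rw [Real.norm_eq_abs, Real.rpow_neg (by positivity), mul_assoc, ← div_eq_mul_inv,
    ← Real.div_rpow (by norm_num) (by positivity)]
  rcases le_total |θ| 1 with h | h
  · have : 1 ≤ (2 / (1 + |θ|)) ^ s :=
      Real.one_le_rpow ((one_le_div (by positivity)).2 (by linarith)) hs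
    nlinarith [h1 θ]
  · have h0 : 0 < |θ| := by linarith
    have : |θ| ^ (-s) ≤ (2 / (1 + |θ|)) ^ s := by
      rw [Real.rpow_neg hn, ← Real.inv_rpow hn]
      refine Real.rpow_le_rpow (by positivity) ?_ hs
      rw [inv_eq_one_div, div_le_div_iff₀ h0 (by positivity)]
      linarith
    have h3 := h2 θ (abs_pos.1 h0)
    have : 0 ≤ (2 / (1 + |θ|)) ^ s := by positivity
    nlinarith

lemma norm_exp_I_mul_sub_one_le_rpow {α : ℝ} (hα : α ∈ Set.Icc (0 : ℝ) 1) (t : ℝ) :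
    ‖Complex.exp (Complex.I * t) - 1‖ ≤ 2 * |t| ^ α := by
  rcases le_total |t| 1 with h | h
  · have h1 : ‖Complex.exp (Complex.I * t) - 1‖ ≤ |t| := Real.norm_exp_I_mul_ofReal_sub_one_le
    have h2 := Real.rpow_le_rpow_of_exponent_ge' (abs_nonneg t) h hα.1 hα.2
    rw [Real.rpow_one] at h2
    have := abs_nonneg t
    linarith
  · have h1 : ‖Complex.exp (Complex.I * t) - 1‖ ≤ 1 + 1 := by
      refine (norm_sub_le _ _).trans (le_of_eq ?_)
      rw [mul_comm, Complex.norm_exp_ofReal_mul_I, norm_one]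
    have h2 := Real.one_le_rpow h hα.1
    linarith

/-- The Fourier transform of a function decaying like `|ξ| ^ (-s)` is `α`-Hölder continuous for
`α < s - 1`. -/
lemma exists_norm_fourier_sub_le {g : ℝ → ℂ} (hg : AEStronglyMeasurable g) {M s α : ℝ}
    (hbound : ∀ ξ, ‖g ξ‖ ≤ M * (1 + ‖ξ‖) ^ (-s)) (hα : α ∈ Set.Icc (0 : ℝ) 1) (hs : α + 1 < s) :
    ∃ K > 0, ∀ x y, ‖𝓕 g x - 𝓕 g y‖ ≤ K * |x - y| ^ α := by
  have hM : 0 ≤ M := by simpa using (norm_nonneg _).trans (hbound 0)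
  have hg_int : Integrable g := ((integrable_one_add_norm (by
    simp; linarith [hα.1])).const_mul M).mono' hg (.of_forall hbound)
  have hdom : Integrable fun ξ : ℝ ↦ (1 + ‖ξ‖) ^ (-(s - α)) :=
    integrable_one_add_norm (by simp; linarith)
  set J := ∫ ξ : ℝ, (1 + ‖ξ‖) ^ (-(s - α)) with hJ
  have hJ0 : 0 ≤ J := integral_nonneg fun ξ ↦ by positivity
  refine ⟨2 * (2 * Real.pi) ^ α * M * J + 1, by positivity, fun x y ↦ ?_⟩
  have hint (z : ℝ) : Integrable fun ξ : ℝ ↦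
      Complex.exp (↑(-2 * Real.pi * ξ * z) * Complex.I) • g ξ := by
    have hexp : Continuous fun ξ : ℝ ↦ Complex.exp (↑(-2 * Real.pi * ξ * z) * Complex.I) := by
      fun_prop
    refine hg_int.mono (hexp.aestronglyMeasurable.smul hg) (.of_forall fun ξ ↦ ?_)
    rw [norm_smul, Complex.norm_exp_ofReal_mul_I, one_mul]
  rw [Real.fourier_real_eq_integral_exp_smul, Real.fourier_real_eq_integral_exp_smul,
    ← integral_sub (hint x) (hint y)]
  have hpt (ξ : ℝ) : ‖Complex.exp (↑(-2 * Real.pi * ξ * x) * Complex.I) • g ξ -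
      Complex.exp (↑(-2 * Real.pi * ξ * y) * Complex.I) • g ξ‖ ≤
      2 * (2 * Real.pi) ^ α * M * |x - y| ^ α * (1 + ‖ξ‖) ^ (-(s - α)) := by
    have hfac : Complex.exp (↑(-2 * Real.pi * ξ * x) * Complex.I) • g ξ -
        Complex.exp (↑(-2 * Real.pi * ξ * y) * Complex.I) • g ξ =
        Complex.exp (↑(-2 * Real.pi * ξ * y) * Complex.I) *
          ((Complex.exp (Complex.I * ↑(-2 * Real.pi * ξ * (x - y))) - 1) * g ξ) := by
      rw [smul_eq_mul, smul_eq_mul, ← mul_assoc, mul_sub, ← Complex.exp_add, mul_one, sub_mul]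
      congr 3
      push_cast
      ring
    have habs : |-2 * Real.pi * ξ * (x - y)| ^ α =
        (2 * Real.pi) ^ α * |x - y| ^ α * |ξ| ^ α := by
      rw [abs_mul, abs_mul, abs_mul, abs_neg, abs_two, abs_of_pos Real.pi_pos,
        Real.mul_rpow (by positivity) (by positivity), Real.mul_rpow (by positivity) (by positivity)]
      ring
    have hξ : |ξ| ^ α ≤ (1 + ‖ξ‖) ^ α :=
      Real.rpow_le_rpow (abs_nonneg _) (by rw [Real.norm_eq_abs]; linarith) hα.1
    rw [hfac, norm_mul, Complex.norm_exp_ofReal_mul_I, one_mul, norm_mul]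
    calc _ ≤ (2 * |-2 * Real.pi * ξ * (x - y)| ^ α) * (M * (1 + ‖ξ‖) ^ (-s)) := by
          gcongr
          exacts [norm_exp_I_mul_sub_one_le_rpow hα _, hbound ξ]
      _ ≤ (2 * ((2 * Real.pi) ^ α * |x - y| ^ α * (1 + ‖ξ‖) ^ α)) * (M * (1 + ‖ξ‖) ^ (-s)) := by
          rw [habs]
          gcongr
      _ = _ := by
          rw [show -(s - α) = α + -s by ring, Real.rpow_add (by positivity)]
          ring
  calc _ ≤ ∫ ξ : ℝ, 2 * (2 * Real.pi) ^ α * M * |x - y| ^ α * (1 + ‖ξ‖) ^ (-(s - α)) :=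
        norm_integral_le_of_norm_le (hdom.const_mul _) (.of_forall hpt)
    _ = 2 * (2 * Real.pi) ^ α * M * J * |x - y| ^ α := by
        rw [integral_const_mul, hJ]
        ring
    _ ≤ _ := by
        have : 0 ≤ |x - y| ^ α := by positivity
        linarith

/- STATEMENT 0: If the characteristic function φ(θ) = E[exp(iθX)] of a real random
variable X satisfies |φ(θ)| ≤ min(1, C|θ|^{-(1+γ)}) (for θ ≠ 0, where the bound is
nontrivial), C > 0, γ ∈ (0,1), then the law of X has a density f which is α-Hölder
continuous for every α ∈ (0, γ). -/
theorem stmt0 {Ω : Type*} [MeasurableSpace Ω] (P : Measure Ω) [IsProbabilityMeasure P]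
    (X : Ω → ℝ) (hX : Measurable X)
    (C γ : ℝ) (hC : 0 < C) (hγ : γ ∈ Set.Ioo (0 : ℝ) 1)
    (hφ : ∀ θ : ℝ, θ ≠ 0 →
      ‖∫ ω, Complex.exp (Complex.I * θ * X ω) ∂P‖ ≤ min 1 (C * |θ| ^ (-(1 + γ)))) :
    ∃ f : ℝ → ℝ, (∀ x, 0 ≤ f x) ∧
      Measure.map X P = volume.withDensity (fun x => ENNReal.ofReal (f x)) ∧
      ∀ α ∈ Set.Ioo (0 : ℝ) γ, ∃ K > 0, ∀ x y : ℝ, |f x - f y| ≤ K * |x - y| ^ α := by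
  have hγ0 := hγ.1
  have : IsProbabilityMeasure (P.map X) := Measure.isProbabilityMeasure_map hX.aemeasurable
  have hchar (θ : ℝ) : charFun (P.map X) θ = ∫ ω, Complex.exp (Complex.I * θ * X ω) ∂P := by
    rw [charFun_apply_real, integral_map hX.aemeasurable
      (Continuous.aestronglyMeasurable (by fun_prop))]
    congr with ω
    congr 1
    ring
  have hdecay (θ : ℝ) (hθ : θ ≠ 0) : ‖charFun (P.map X) θ‖ ≤ C * |θ| ^ (-(1 + γ)) := by
    rw [hchar]
    exact (hφ θ hθ).trans (min_le_right _ _)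
  have hint : Integrable (charFun (P.map X)) :=
    ((integrable_one_add_norm (r := 1 + γ) (by simp; linarith)).const_mul _).mono'
      measurable_charFun.aestronglyMeasurable
      (.of_forall (norm_charFun_le_japaneseBracket hC.le (by linarith) norm_charFun_le_one hdecay))
  obtain ⟨f, hf0, hf, hμ⟩ := exists_density_of_integrable_charFun (P.map X) hint
  refine ⟨f, hf0, hμ, fun α hα ↦ ?_⟩
  have hscaled (θ : ℝ) (hθ : θ ≠ 0) :
      ‖charFun (P.map X) (2 * Real.pi * θ)‖ ≤
        C * (2 * Real.pi) ^ (-(1 + γ)) * |θ| ^ (-(1 + γ)) := by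
    refine (hdecay _ (by positivity)).trans_eq ?_
    rw [abs_mul, abs_of_pos Real.two_pi_pos, Real.mul_rpow (by positivity) (abs_nonneg _),
      mul_assoc]
  obtain ⟨K, hK, hKf⟩ := exists_norm_fourier_sub_le (α := α)
    (measurable_charFun.comp (measurable_const_mul (2 * Real.pi))).aestronglyMeasurable
    (norm_charFun_le_japaneseBracket (by positivity) (by linarith)
      (fun θ ↦ norm_charFun_le_one _) hscaled)
    ⟨hα.1.le, (hα.2.trans hγ.2).le⟩ (by linarith [hα.2])
  refine ⟨K, hK, fun x y ↦ ?_⟩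
  have h := hKf x y
  rw [show charFun (P.map X) ∘ (fun x ↦ 2 * Real.pi * x) =
    fun ξ ↦ charFun (P.map X) (2 * Real.pi * ξ) from rfl, hf, hf,
    ← Complex.ofReal_sub, Complex.norm_real] at h
  exact h
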